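/- Every (finite-by-abelian)-by-finite group is nilpotent-by-finite of class at most 2: if G is a group, A a normal subgroup of G of finite index, and F a finite normal subgroup of A with A/F abelian, then the subgroup C_A(A') (the centraliser in A of the derived subgroup A' of A) is a normal subgroup of G of finite index which is nilpotent of nilpotency class at most 2. -/

import Mathlib

/-- The centralizer of a finite normal subgroup has finite index. -/
theorem Subgroup.finiteIndex_centralizer_of_finite_of_normal {G : Type*} [Group G]
    (K : Subgroup G) [K.Normal] [Finite K] :
    (Subgroup.centralizer (K : Set G)).FiniteIndex := by
  have : Finite (MulAut K) := Finite.of_injective _ DFunLike.coe_injective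
  refine Subgroup.finiteIndex_of_le (H := (MulAut.conjNormal (H := K)).ker) fun g hg => ?_
  rw [Subgroup.mem_centralizer_iff]
  intro k hk
  have h : g * k * g⁻¹ = k := by
    rw [← MulAut.conjNormal_apply g ⟨k, hk⟩, MonoidHom.mem_ker.mp hg, MulAut.one_apply]
  exact (mul_inv_eq_iff_eq_mul.mp h).symm

open scoped commutatorElement in
/-- If `A / F` is abelian then `⁅A, A⁆ ≤ F`. -/
theorem Subgroup.commutator_le_of_quotient_subgroupOf_comm {G : Type*} [Group G]
    (A F : Subgroup G) [(F.subgroupOf A).Normal]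
    (habel : ∀ x y : A ⧸ F.subgroupOf A, x * y = y * x) : ⁅A, A⁆ ≤ F := by
  refine Subgroup.commutator_le.mpr fun x hx y hy => ?_
  have h : ((⁅(⟨x, hx⟩ : A), ⟨y, hy⟩⁆ : A) : A ⧸ F.subgroupOf A) = 1 :=
    commutatorElement_eq_one_iff_mul_comm.mpr (habel (⟨x, hx⟩ : A) (⟨y, hy⟩ : A))
  exact Subgroup.mem_subgroupOf.mp ((QuotientGroup.eq_one_iff _).mp h)

/-- Every (finite-by-abelian)-by-finite group is nilpotent-by-finite of class at most 2:
if `A` is a normal subgroup of finite index of `G` and `F` is a finite normal subgroup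
of `A` with `A/F` abelian, then `C_A(A') = A ⊓ C_G(⁅A,A⁆)` is a normal subgroup of `G`
of finite index which is nilpotent of class at most 2, i.e. `⁅⁅N,N⁆,N⁆ = 1`. -/
theorem finite_by_abelian_by_finite_is_nilpotent_by_finite {G : Type*} [Group G]
    (A F : Subgroup G) [A.Normal] [A.FiniteIndex] (hFA : F ≤ A)
    [(F.subgroupOf A).Normal] (hF : (F : Set G).Finite)
    (habel : ∀ x y : A ⧸ F.subgroupOf A, x * y = y * x) :
    (A ⊓ Subgroup.centralizer ((⁅A, A⁆ : Subgroup G) : Set G)).Normal ∧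
    (A ⊓ Subgroup.centralizer ((⁅A, A⁆ : Subgroup G) : Set G)).FiniteIndex ∧
    ⁅⁅A ⊓ Subgroup.centralizer ((⁅A, A⁆ : Subgroup G) : Set G),
        A ⊓ Subgroup.centralizer ((⁅A, A⁆ : Subgroup G) : Set G)⁆,
      A ⊓ Subgroup.centralizer ((⁅A, A⁆ : Subgroup G) : Set G)⁆ = (⊥ : Subgroup G) := by
  have : Finite F := hF
  have hKF := Subgroup.commutator_le_of_quotient_subgroupOf_comm A F habel
  have : Finite (⁅A, A⁆ : Subgroup G) :=
    Finite.of_injective _ (Subgroup.inclusion_injective hKF)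
  have := Subgroup.finiteIndex_centralizer_of_finite_of_normal (⁅A, A⁆ : Subgroup G)
  refine ⟨inferInstance, inferInstance, ?_⟩
  rw [Subgroup.commutator_eq_bot_iff_le_centralizer]
  refine (Subgroup.commutator_mono inf_le_left inf_le_left).trans ?_
  rw [Subgroup.le_centralizer_iff]
  exact inf_le_right
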